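/- For 0 < q ≤ ∞ and positive integers n < m, the continuous nonlinear n-width of the ℓ_∞ unit ball in ℓ_q^m satisfies τ_n(B_∞^m, ℓ_q^m) ≥ (1/2)(m − n − 1)^{1/q}. -/

import Mathlib

open MeasureTheory ENNReal

/-- `Σ_n(Φ)`: linear combinations of at most `n` elements of the family `Φ`. -/
def SigmaN {E : Type*} [AddCommGroup E] [Module ℝ E] (n : ℕ) (Φ : Set E) : Set E :=
  {y | ∃ (c : Fin n → ℝ) (φ : Fin n → E), (∀ j, φ j ∈ Φ) ∧ y = ∑ j, c j • φ j}

/-- The continuous nonlinear `n`-width `τ_n(W, ℓ_q^m)` on `ℝ^m`, with the error measured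
in the `ℓ_q` quasi-norm (realized as the `L_q` norm for counting measure); continuity is
with respect to the (unique) vector space topology of `ℝ^m`. -/
noncomputable def tauLq {m : ℕ} (q : ℝ≥0∞) (n : ℕ) (W : Set (Fin m → ℝ)) : ℝ≥0∞ :=
  sInf {e : ℝ≥0∞ | ∃ Φ : Set (Fin m → ℝ), Bornology.IsBounded Φ ∧
    (∀ L : Subspace ℝ (Fin m → ℝ), (Φ ∩ (L : Set (Fin m → ℝ))).Finite) ∧
    ∃ S : (Fin m → ℝ) → (Fin m → ℝ), Continuous S ∧ Set.range S ⊆ SigmaN n Φ ∧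
      ∀ x ∈ W, eLpNorm (x - S x) q Measure.count ≤ e}

/-- `t ↦ det (1 + t A)` is a polynomial of degree at most `m`. -/
theorem det_poly {m : ℕ} (A : (Fin m → ℝ) →L[ℝ] (Fin m → ℝ)) :
    ∃ P : Polynomial ℝ, P.natDegree ≤ m ∧
      ∀ t : ℝ, P.eval t = (ContinuousLinearMap.id ℝ (Fin m → ℝ) + t • A).det := by
  let M := LinearMap.toMatrix' (A : (Fin m → ℝ) →ₗ[ℝ] (Fin m → ℝ))
  refine ⟨Matrix.det ((Polynomial.X : Polynomial ℝ) • M.map Polynomial.C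
    + (1 : Matrix (Fin m) (Fin m) ℝ).map Polynomial.C), ?_, ?_⟩
  · simpa using Polynomial.natDegree_det_X_add_C_le M 1
  · intro t
    rw [← Polynomial.coe_evalRingHom, RingHom.map_det, ContinuousLinearMap.det,
      ← LinearMap.det_toMatrix']
    congr 1
    ext i j
    by_cases hij : i = j
    · subst hij
      simp [M, LinearMap.toMatrix'_apply]
      ring
    · simp [M, LinearMap.toMatrix'_apply, hij]
      ring

/-- small perturbations of the identity have positive determinant -/
theorem det_pos_near {m : ℕ} : ∃ ε : ℝ, 0 < ε ∧ ∀ A : (Fin m → ℝ) →L[ℝ] (Fin m → ℝ), ‖A‖ < ε →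
    0 < (ContinuousLinearMap.id ℝ (Fin m → ℝ) + A).det := by
  have hc : Continuous (fun A : (Fin m → ℝ) →L[ℝ] (Fin m → ℝ) =>
      (ContinuousLinearMap.id ℝ (Fin m → ℝ) + A).det) :=
    ContinuousLinearMap.continuous_det.comp (continuous_const.add continuous_id)
  have h0 : 0 < (ContinuousLinearMap.id ℝ (Fin m → ℝ) + 0).det := by
    simp [ContinuousLinearMap.det]
  have := hc.continuousAt.eventually (lt_mem_nhds h0)
  obtain ⟨ε, hε, h⟩ := Metric.eventually_nhds_iff.1 this
  exact ⟨ε, hε, fun A hA => h (by simpa using hA)⟩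

theorem small_bij {m : ℕ} (g : (Fin m → ℝ) → (Fin m → ℝ)) (K : NNReal) (hK : LipschitzWith K g)
    (hg : ∀ x, 1 < ‖x‖ → g x = 0) (t : ℝ) (ht : ‖t‖₊ * K < 1) :
    Function.Injective (fun x => x + t • g x) ∧
    (fun x => x + t • g x) '' Metric.closedBall 0 1 = Metric.closedBall 0 1 := by
  have hap : ApproximatesLinearOn (fun x => x + t • g x)
      ((ContinuousLinearEquiv.refl ℝ (Fin m → ℝ)) : (Fin m → ℝ) →L[ℝ] (Fin m → ℝ))
      Set.univ (‖t‖₊ * K) := by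
    intro x _ y _
    have : (x + t • g x) - (y + t • g y) -
      (ContinuousLinearEquiv.refl ℝ (Fin m → ℝ) : (Fin m → ℝ) →L[ℝ] (Fin m → ℝ)) (x - y)
        = t • (g x - g y) := by
      simp [smul_sub]; abel
    rw [this, norm_smul]
    have := hK.norm_sub_le x y
    simp only [NNReal.coe_mul, coe_nnnorm, mul_assoc]
    gcongr
  have hN : Subsingleton (Fin m → ℝ) ∨ ‖t‖₊ * K <
      ‖((ContinuousLinearEquiv.refl ℝ (Fin m → ℝ)).symm :
        (Fin m → ℝ) →L[ℝ] (Fin m → ℝ))‖₊⁻¹ := by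
    rcases subsingleton_or_nontrivial (Fin m → ℝ) with h | h
    · exact Or.inl h
    · right
      have : ‖((ContinuousLinearEquiv.refl ℝ (Fin m → ℝ)).symm :
        (Fin m → ℝ) →L[ℝ] (Fin m → ℝ))‖₊ = 1 := by
        apply NNReal.eq
        exact ContinuousLinearMap.norm_id
      rw [this]; simpa using ht
  have hinj : Function.Injective (fun x => x + t • g x) := by
    have := hap.injOn hN
    exact Set.injOn_univ.1 this
  have hsurj := hap.surjective hN
  refine ⟨hinj, ?_⟩
  have hout : ∀ x, 1 < ‖x‖ → x + t • g x = x := fun x hx => by simp [hg x hx]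
  ext y
  simp only [Set.mem_image, Metric.mem_closedBall, dist_zero_right]
  constructor
  · rintro ⟨x, hx, rfl⟩
    by_contra hy
    push Not at hy
    have := hinj (a₁ := x + t • g x) (a₂ := x) (hout _ hy)
    rw [this] at hy
    linarith
  · intro hy
    obtain ⟨x, hx⟩ := hsurj y
    refine ⟨x, ?_, hx⟩
    by_contra h
    push Not at h
    have h2 := hout x h
    simp only at hx
    rw [h2] at hx
    rw [hx] at h
    linarith

/-- Change of variables, extended from small `t` to `t = 1` by polynomiality. -/
theorem cov_poly {m : ℕ} (g : (Fin m → ℝ) → (Fin m → ℝ)) (hgs : ContDiff ℝ 1 g)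
    (hg : ∀ x, 1 < ‖x‖ → g x = 0) (w : (Fin m → ℝ) → ℝ) (hw : Continuous w) (D : ℕ)
    (hwp : ∀ x v, ∃ P : Polynomial ℝ, P.natDegree ≤ D ∧ ∀ t : ℝ, P.eval t = w (x + t • v)) :
    ∫ x in Metric.closedBall (0 : Fin m → ℝ) 1,
      (ContinuousLinearMap.id ℝ (Fin m → ℝ) + fderiv ℝ g x).det * w (x + g x)
      = ∫ x in Metric.closedBall (0 : Fin m → ℝ) 1, w x := by
  have hcs : HasCompactSupport g := by
    apply HasCompactSupport.intro (isCompact_closedBall (0 : Fin m → ℝ) 1)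
    intro x hx
    apply hg
    simpa using hx
  obtain ⟨K, hK⟩ := hgs.lipschitzWith_of_hasCompactSupport hcs (by simp)
  obtain ⟨ε, hε, hdet⟩ := det_pos_near (m := m)
  have hfd : ∀ x, ‖fderiv ℝ g x‖ ≤ K := fun x => norm_fderiv_le_of_lipschitz ℝ hK
  have hdiff : Differentiable ℝ g := hgs.differentiable (by simp)
  have hfc : Continuous (fderiv ℝ g) := hgs.continuous_fderiv (by simp)
  let I : ℝ → ℝ := fun t => ∫ x in Metric.closedBall (0 : Fin m → ℝ) 1,
      (ContinuousLinearMap.id ℝ (Fin m → ℝ) + t • fderiv ℝ g x).det * w (x + t • g x)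
  have hsmall : ∀ t : ℝ, |t| * K < min 1 ε →
      I t = ∫ x in Metric.closedBall (0 : Fin m → ℝ) 1, w x := by
    intro t ht
    obtain ⟨hinj, him⟩ := small_bij g K hK hg t (by
      rw [← NNReal.coe_lt_coe]; simpa using ht.trans_le (min_le_left _ _))
    have := integral_image_eq_integral_abs_det_fderiv_smul volume
      (s := Metric.closedBall (0 : Fin m → ℝ) 1) (f := fun x => x + t • g x)
      (f' := fun x => ContinuousLinearMap.id ℝ (Fin m → ℝ) + t • fderiv ℝ g x)
      Metric.isClosed_closedBall.measurableSet
      (fun x _ => ((hasFDerivAt_id x).add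
        ((hdiff x).hasFDerivAt.const_smul t)).hasFDerivWithinAt) hinj.injOn w
    rw [him] at this
    rw [this]
    refine integral_congr_ae (Filter.Eventually.of_forall fun x => ?_)
    simp only [smul_eq_mul]
    rw [abs_of_pos]
    apply hdet
    rw [norm_smul]
    calc ‖t‖ * ‖fderiv ℝ g x‖ ≤ |t| * K := by
          rw [Real.norm_eq_abs]; gcongr; exact hfd x
      _ < ε := ht.trans_le (min_le_right _ _)
  obtain ⟨t0, ht0, hsm⟩ : ∃ t0 : ℝ, 0 < t0 ∧ t0 * K < min 1 ε := by
    have hm : 0 < min 1 ε := lt_min one_pos hε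
    refine ⟨min 1 ε / (K + 1), by positivity, ?_⟩
    rw [div_mul_eq_mul_div, div_lt_iff₀ (by positivity)]
    nlinarith [K.coe_nonneg]
  let s := Finset.range (m + D + 1)
  let v : ℕ → ℝ := fun j => t0 / (j + 1)
  have hv : Set.InjOn v s := by
    intro a _ b _ hab
    simp only [v] at hab
    have ha : (a : ℝ) + 1 ≠ 0 := by positivity
    have hb : (b : ℝ) + 1 ≠ 0 := by positivity
    rw [div_eq_div_iff ha hb] at hab
    have := mul_left_cancel₀ ht0.ne' hab
    have h3 : (a : ℝ) = b := by linarith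
    exact_mod_cast h3
  have hsne : s.Nonempty := ⟨0, by simp [s]⟩
  have hpt : ∀ x, (ContinuousLinearMap.id ℝ (Fin m → ℝ) + fderiv ℝ g x).det * w (x + g x)
      = ∑ j ∈ s, (Lagrange.basis s v j).eval 1 *
        ((ContinuousLinearMap.id ℝ (Fin m → ℝ) + v j • fderiv ℝ g x).det * w (x + v j • g x)) := by
    intro x
    obtain ⟨P, hPd, hP⟩ := hwp x (g x)
    obtain ⟨Q, hQd, hQ⟩ := det_poly (fderiv ℝ g x)
    have hdeg : (Q * P).degree < s.card := by
      apply lt_of_le_of_lt Polynomial.degree_le_natDegree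
      have := Polynomial.natDegree_mul_le (p := Q) (q := P)
      simp only [s, Finset.card_range]
      exact_mod_cast (by omega)
    have h := Lagrange.eq_interpolate hv hdeg
    have h1 := congrArg (Polynomial.eval 1) h
    rw [Lagrange.interpolate_apply, Polynomial.eval_finsetSum] at h1
    simp only [Polynomial.eval_mul, Polynomial.eval_C, hP, hQ, one_smul] at h1
    rw [h1]
    exact Finset.sum_congr rfl fun j _ => by ring
  have hcont : ∀ t : ℝ, Continuous (fun x => 
      (ContinuousLinearMap.id ℝ (Fin m → ℝ) + t • fderiv ℝ g x).det * w (x + t • g x)) := by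
    intro t
    refine (ContinuousLinearMap.continuous_det.comp
      (continuous_const.add (hfc.const_smul t))).mul (hw.comp ?_)
    exact continuous_id.add (hgs.continuous.const_smul t)
  simp_rw [hpt]
  rw [integral_finsetSum]
  · simp_rw [integral_const_mul]
    have : ∀ j ∈ s, (Lagrange.basis s v j).eval 1 * I (v j) = (Lagrange.basis s v j).eval 1 *
        ∫ x in Metric.closedBall (0 : Fin m → ℝ) 1, w x := by
      intro j _
      rw [hsmall]
      have : |v j| ≤ t0 := by
        simp only [v]
        rw [abs_of_pos (by positivity)]
        exact div_le_self ht0.le (by linarith [(Nat.cast_nonneg j : (0:ℝ) ≤ j)])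
      calc |v j| * K ≤ t0 * K := by gcongr
        _ < _ := hsm
    rw [Finset.sum_congr rfl this, ← Finset.sum_mul, ← Polynomial.eval_finsetSum,
      Lagrange.sum_basis hv hsne]
    simp
  · intro j _
    exact (continuous_const.mul (hcont (v j))).continuousOn.integrableOn_compact (isCompact_closedBall _ _)

theorem no_avoid_smooth {m : ℕ} (hm : 0 < m) (g : (Fin m → ℝ) → (Fin m → ℝ))
    (hgs : ContDiff ℝ 1 g) (hg : ∀ x, 1 < ‖x‖ → g x = 0) (δ : ℝ) (hδ : 0 < δ)
    (hlow : ∀ x, ‖x‖ ≤ 1 → δ ≤ ‖x + g x‖) (hup : ∀ x, ‖x‖ ≤ 1 → ‖x + g x‖ ≤ 2) : False := by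
  have hm1 : (1 : ℝ) ≤ m := by exact_mod_cast hm
  have hδ2 : δ ≤ 2 := (hlow 0 (by simp)).trans (hup 0 (by simp))
  set A : ℝ := 4 * m with hA
  have hApos : 0 < A := by positivity
  let B := Metric.closedBall (0 : Fin m → ℝ) 1
  let Q : (Fin m → ℝ) → ℝ := fun y => ∑ i, y i ^ 2
  have hQc : Continuous Q := by fun_prop
  have hQup : ∀ (y : Fin m → ℝ) (r : ℝ), ‖y‖ ≤ r → Q y ≤ m * r ^ 2 := by
    intro y r hy
    calc Q y ≤ ∑ _i : Fin m, r ^ 2 := by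
          apply Finset.sum_le_sum
          intro i _
          rw [← sq_abs]
          have := (norm_le_pi_norm y i).trans hy
          rw [Real.norm_eq_abs] at this
          gcongr
      _ = m * r ^ 2 := by simp
  have hQlow : ∀ (y : Fin m → ℝ), δ ≤ ‖y‖ → δ ^ 2 ≤ Q y := by
    intro y hy
    have : Nonempty (Fin m) := ⟨⟨0, hm⟩⟩
    obtain ⟨i, hi⟩ : ∃ i, δ ≤ ‖y i‖ := by
      by_contra h
      push Not at h
      exact absurd ((pi_norm_lt_iff hδ).2 h) (not_lt.2 hy)
    calc δ ^ 2 ≤ y i ^ 2 := by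
          rw [← sq_abs (y i)]; rw [Real.norm_eq_abs] at hi; gcongr
      _ ≤ Q y := Finset.single_le_sum (f := fun i => y i ^ 2) (fun i _ => sq_nonneg _)
          (Finset.mem_univ i)
  set a : ℝ := 1 - δ ^ 2 / A with ha
  set r : ℝ := δ / (2 * m) with hr
  have hrpos : 0 < r := by positivity
  have hr1 : r ≤ 1 := by
    rw [hr, div_le_one (by positivity)]; linarith
  set b : ℝ := 1 - m * r ^ 2 / A with hb
  have hmr : m * r ^ 2 < δ ^ 2 := by
    have : m * r ^ 2 = δ ^ 2 / (4 * m) := by rw [hr]; field_simp; ring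
    rw [this, div_lt_iff₀ (by positivity)]
    nlinarith [sq_nonneg δ, pow_pos hδ 2]
  have hab : a < b := by
    rw [ha, hb]; gcongr
  have ha0 : 0 ≤ a := by
    rw [ha, sub_nonneg, div_le_one hApos]; nlinarith
  have hb0 : 0 < b := ha0.trans_lt hab
  set c : ℝ := (volume (Metric.closedBall (0 : Fin m → ℝ) r)).toReal with hc
  have hcpos : 0 < c := by
    apply ENNReal.toReal_pos
    · exact (Metric.measure_closedBall_pos _ _ hrpos).ne'
    · exact measure_closedBall_lt_top.ne
  let J : (Fin m → ℝ) → ℝ := fun x => (ContinuousLinearMap.id ℝ (Fin m → ℝ) + fderiv ℝ g x).det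
  have hJ : Continuous J := ContinuousLinearMap.continuous_det.comp
      (continuous_const.add (hgs.continuous_fderiv (by simp)))
  set C : ℝ := ∫ x in B, |J x| with hC
  have hBc : IsCompact B := isCompact_closedBall _ _
  have key : ∀ N : ℕ, b ^ N * c ≤ C * a ^ N := by
    intro N
    let w : (Fin m → ℝ) → ℝ := fun y => (1 - Q y / A) ^ N
    have hwc : Continuous w := by fun_prop
    have hcov := cov_poly g hgs hg w hwc (2 * N) (by
      intro x v
      refine ⟨(1 - Polynomial.C A⁻¹ *
        ∑ i, (Polynomial.C (x i) + Polynomial.X * Polynomial.C (v i)) ^ 2) ^ N, ?_, ?_⟩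
      · rw [mul_comm 2 N]
        refine Polynomial.natDegree_pow_le_of_le N ?_
        refine (Polynomial.natDegree_sub_le_of_le (m := 0) (n := 2) (by simp) ?_).trans (by simp)
        refine (Polynomial.natDegree_C_mul_le _ _).trans ?_
        refine Polynomial.natDegree_sum_le_of_forall_le _ _ ?_
        intro i _
        compute_degree
      · intro t
        simp [w, Q, Polynomial.eval_finsetSum, div_eq_inv_mul]
        simp only [mul_comm t])
    have hL : ∫ x in B, J x * w (x + g x) ≤ C * a ^ N := by
      rw [hC, ← integral_mul_const]
      apply setIntegral_mono_on
      · exact (hJ.mul (hwc.comp (continuous_id.add hgs.continuous))).continuousOn.integrableOn_compact hBc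
      · exact (hJ.abs.mul continuous_const).continuousOn.integrableOn_compact hBc
      · exact Metric.isClosed_closedBall.measurableSet
      · intro x hx
        have hx1 : ‖x‖ ≤ 1 := by simpa [B] using hx
        have h1 := hQlow _ (hlow x hx1)
        have h2 := hQup _ _ (hup x hx1)
        have h3 : 0 ≤ 1 - Q (x + g x) / A := by
          rw [sub_nonneg, div_le_one hApos]; linarith
        have h4 : w (x + g x) ≤ a ^ N := by
          apply pow_le_pow_left₀ h3
          rw [ha]; gcongr
        have h5 : 0 ≤ w (x + g x) := pow_nonneg h3 N
        calc J x * w (x + g x) ≤ |J x| * w (x + g x) := by gcongr; exact le_abs_self _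
          _ ≤ _ := by gcongr
    have hR : b ^ N * c ≤ ∫ x in B, w x := by
      have hsub : Metric.closedBall (0 : Fin m → ℝ) r ⊆ B := Metric.closedBall_subset_closedBall hr1
      calc b ^ N * c = ∫ _x in Metric.closedBall (0 : Fin m → ℝ) r, b ^ N := by
            simp [hc, Measure.real, mul_comm]
        _ ≤ ∫ x in Metric.closedBall (0 : Fin m → ℝ) r, w x := by
            apply setIntegral_mono_on
            · exact continuous_const.continuousOn.integrableOn_compact (isCompact_closedBall _ _)
            · exact hwc.continuousOn.integrableOn_compact (isCompact_closedBall _ _)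
            · exact Metric.isClosed_closedBall.measurableSet
            · intro x hx
              have hx1 : ‖x‖ ≤ r := by simpa using hx
              apply pow_le_pow_left₀ hb0.le
              rw [hb]
              have := hQup x r hx1
              gcongr
        _ ≤ ∫ x in B, w x := by
            apply setIntegral_mono_set
            · exact hwc.continuousOn.integrableOn_compact hBc
            · refine (ae_restrict_iff' Metric.isClosed_closedBall.measurableSet).2
                (Filter.Eventually.of_forall fun x hx => ?_)
              have hx1 : ‖x‖ ≤ 1 := by simpa using hx
              have h2 := hQup _ _ hx1
              apply pow_nonneg
              rw [sub_nonneg, div_le_one hApos]; linarith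
            · exact Filter.Eventually.of_forall hsub
    linarith [hcov]
  have hlim : Filter.Tendsto (fun N : ℕ => C * (a / b) ^ N) Filter.atTop (nhds (C * 0)) :=
    (tendsto_pow_atTop_nhds_zero_of_lt_one (by positivity) ((div_lt_one hb0).2 hab)).const_mul C
  have : c ≤ C * 0 := by
    refine ge_of_tendsto hlim (Filter.Eventually.of_forall fun N => ?_)
    rw [div_pow, ← mul_div_assoc, le_div_iff₀ (by positivity)]
    linarith [key N]
  linarith

theorem no_avoid {m : ℕ} (hm : 0 < m) (F : (Fin m → ℝ) → (Fin m → ℝ))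
    (hF : Continuous F) (hd : ∀ x, ‖x‖ ≤ 1 → ‖F x - x‖ ≤ 3 / 5) (δ : ℝ) (hδ : 0 < δ)
    (hlow : ∀ x, ‖x‖ ≤ 1 → δ ≤ ‖F x‖) : False := by
  let χ : ContDiffBump (0 : Fin m → ℝ) := ⟨9 / 10, 1, by norm_num, by norm_num⟩
  let d : (Fin m → ℝ) → (Fin m → ℝ) := fun x => χ x • (F x - x)
  have hdc : Continuous d := χ.continuous.smul (hF.sub continuous_id)
  set ε : ℝ := min (δ / 2) (1 / 10) with hε
  have hεpos : 0 < ε := by positivity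
  obtain ⟨g, hgs, happ, hsupp⟩ := hdc.exists_contDiff_approx 1 (ε := fun _ => ε)
    continuous_const (fun _ => hεpos)
  have hε1 : ε ≤ δ / 2 := min_le_left _ _
  have hε2 : ε ≤ 1 / 10 := min_le_right _ _
  have happ' : ∀ x, ‖g x - d x‖ < ε := fun x => by simpa [dist_eq_norm] using happ x
  have hdn : ∀ x, ‖x‖ ≤ 1 → ‖d x‖ ≤ 3 / 5 := by
    intro x hx
    rw [norm_smul, Real.norm_of_nonneg χ.nonneg]
    have := hd x hx
    nlinarith [χ.nonneg (x := x), χ.le_one (x := x), norm_nonneg (F x - x)]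
  refine no_avoid_smooth hm g (by exact_mod_cast hgs) ?_ (min (δ / 2) (1 / 10)) hεpos ?_ ?_
  · intro x hx
    by_contra h
    have h1 : x ∈ Function.support d := hsupp h
    apply h1
    have : χ x = 0 := χ.zero_of_le_dist (by simpa [χ] using hx.le)
    simp [d, this]
  · intro x hx
    rw [← hε]
    by_cases hx9 : ‖x‖ ≤ 9 / 10
    · have : χ x = 1 := χ.one_of_mem_closedBall (by simpa [χ] using hx9)
      have hF1 : F x = (x + g x) - (g x - d x) := by simp only [d, this, one_smul]; abel
      have := norm_sub_le (x + g x) (g x - d x)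
      rw [← hF1] at this
      linarith [hlow x hx, happ' x]
    · push Not at hx9
      have h1 : x = (x + g x) - (g x - d x) - d x := by abel
      have h2 := norm_sub_le ((x + g x) - (g x - d x)) (d x)
      rw [← h1] at h2
      have h3 := norm_sub_le (x + g x) (g x - d x)
      linarith [happ' x, hdn x hx]
  · intro x hx
    have h1 : x + g x = x + (g x - d x) + d x := by abel
    rw [h1]
    have := norm_add₃_le (a := x) (b := g x - d x) (c := d x)
    linarith [happ' x, hdn x hx]

theorem count_large {m : ℕ} (q : ℝ≥0∞) (hq : 0 < q) (k : ℕ) (y : Fin m → ℝ) (e : ℝ≥0∞)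
    (he : e < (1 / 2 : ℝ≥0∞) * (k : ℝ≥0∞) ^ (1 / q.toReal))
    (hy : eLpNorm y q Measure.count ≤ e) :
    (Finset.univ.filter (fun i => 1 / 2 < |y i|)).card ≤ k := by
  have hhalf : ENNReal.ofReal (1 / 2) = 1 / 2 := by
    rw [ENNReal.ofReal_div_of_pos (by norm_num)]; simp
  by_cases hqt : q = ⊤
  · subst hqt
    simp only [ENNReal.toReal_top, _root_.div_zero, ENNReal.rpow_zero, mul_one] at he
    rw [eLpNorm_exponent_top] at hy
    have h1 : ∀ᵐ i ∂(Measure.count : Measure (Fin m)), ‖y i‖ₑ ≤ eLpNormEssSup y Measure.count :=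
      ae_le_eLpNormEssSup
    rw [Measure.ae_count_iff] at h1
    have : (Finset.univ.filter (fun i => 1 / 2 < |y i|)) = ∅ := by
      ext i
      simp only [Finset.mem_filter, Finset.mem_univ, true_and, Finset.notMem_empty, iff_false,
        not_lt]
      have h2 := ((h1 i).trans hy).trans he.le
      rw [Real.enorm_eq_ofReal_abs, ← hhalf] at h2
      exact (ENNReal.ofReal_le_ofReal_iff (by norm_num)).1 h2
    rw [this]; simp
  · have hp : 0 < q.toReal := ENNReal.toReal_pos hq.ne' hqt
    have h1 := mul_meas_ge_le_pow_eLpNorm' (Measure.count : Measure (Fin m)) hq.ne' hqt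
      (f := y) (by fun_prop) (1 / 2)
    have h2 : eLpNorm y q Measure.count ^ q.toReal
        ≤ (1 / 2 : ℝ≥0∞) ^ q.toReal * k := by
      calc eLpNorm y q Measure.count ^ q.toReal
          ≤ ((1 / 2 : ℝ≥0∞) * (k : ℝ≥0∞) ^ (1 / q.toReal)) ^ q.toReal := by
            gcongr; exact hy.trans he.le
        _ = _ := by
            rw [ENNReal.mul_rpow_of_nonneg _ _ hp.le, ← ENNReal.rpow_mul,
              one_div_mul_cancel hp.ne', ENNReal.rpow_one]
    have h3 := h1.trans h2
    have hne : (1 / 2 : ℝ≥0∞) ^ q.toReal ≠ 0 :=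
      (ENNReal.rpow_pos (by simp) (by simp)).ne'
    have hnt : (1 / 2 : ℝ≥0∞) ^ q.toReal ≠ ⊤ :=
      ENNReal.rpow_ne_top_of_nonneg hp.le (by simp)
    rw [ENNReal.mul_le_mul_iff_right hne hnt] at h3
    have h4 : (((Finset.univ.filter (fun i => 1 / 2 < |y i|)).card : ℕ) : ℝ≥0∞) ≤ k := by
      rw [← Measure.count_apply_finset]
      refine (measure_mono ?_).trans h3
      intro i hi
      simp only [Finset.coe_filter, Finset.mem_univ, true_and, Set.mem_ofPred_eq] at hi
      simp only [Set.mem_ofPred_eq]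
      rw [Real.enorm_eq_ofReal_abs, ← hhalf]
      exact ENNReal.ofReal_le_ofReal hi.le
    exact_mod_cast h4

/-- For `0 < q ≤ ∞` and positive integers `n < m`, the continuous nonlinear `n`-width of
the unit ball `B_∞^m` in `ℓ_q^m` satisfies `τ_n(B_∞^m, ℓ_q^m) ≥ (1/2)(m-n-1)^{1/q}`. -/
theorem tau_linfty_ball_lower (q : ℝ≥0∞) (hq : 0 < q) (n m : ℕ) (hn : 0 < n) (hnm : n < m) :
    (1 / 2 : ℝ≥0∞) * ((m : ℝ≥0∞) - n - 1) ^ (1 / q.toReal)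
      ≤ tauLq q n {x : Fin m → ℝ | ∀ i, |x i| ≤ 1} := by
  have hk : ((m : ℝ≥0∞) - n - 1) = ((m - n - 1 : ℕ) : ℝ≥0∞) := by push_cast; rfl
  rw [hk]
  set k := m - n - 1 with hkdef
  refine le_sInf ?_
  rintro e ⟨Φ, -, hΦ, S, hS, hSr, herr⟩
  by_contra hlt
  push Not at hlt
  have hΦf : Φ.Finite := by simpa using hΦ ⊤
  have := hΦf.to_subtype
  let V : (Fin n → Φ) × Finset (Fin m) → Submodule ℝ (Fin m → ℝ) := fun p =>
    Submodule.span ℝ (Set.range fun j => (p.1 j : Fin m → ℝ)) ⊔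
      Submodule.span ℝ (((p.2.image fun i => (Pi.single i 1 : Fin m → ℝ)) : Finset (Fin m → ℝ)) :
        Set (Fin m → ℝ))
  have hVtop : ∀ p, p.2.card ≤ k → V p ≠ ⊤ := by
    intro p hp htop
    have h1 := Submodule.finrank_add_le_finrank_add_finrank
      (Submodule.span ℝ (Set.range fun j => (p.1 j : Fin m → ℝ)))
      (Submodule.span ℝ (((p.2.image fun i => (Pi.single i 1 : Fin m → ℝ)) :
        Finset (Fin m → ℝ)) : Set (Fin m → ℝ)))
    have h2 := finrank_range_le_card (R := ℝ) (fun j => (p.1 j : Fin m → ℝ))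
    have h3 := finrank_span_finset_le_card (R := ℝ)
      (p.2.image fun i => (Pi.single i 1 : Fin m → ℝ))
    have h4 : (p.2.image fun i => (Pi.single i 1 : Fin m → ℝ)).card ≤ p.2.card :=
      Finset.card_image_le
    have h5 : Module.finrank ℝ (V p) = m := by rw [htop]; simp
    simp only [V] at h5
    simp only [Set.finrank, Fintype.card_fin] at h2 h3
    omega
  let K : Set (Fin m → ℝ) := ⋃ p ∈ {p : (Fin n → Φ) × Finset (Fin m) | p.2.card ≤ k},
    (V p : Set (Fin m → ℝ))
  have hKc : IsClosed K := by
    refine Set.Finite.isClosed_biUnion (Set.toFinite _) ?_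
    intro p _
    exact (V p).closed_of_finiteDimensional
  have hKnull : volume K = 0 := by
    refine (measure_biUnion_null_iff (Set.toFinite _).countable).2 ?_
    intro p hp
    exact Measure.addHaar_submodule volume (V p) (hVtop p hp)
  obtain ⟨z, hz, hzK⟩ : ∃ z ∈ Metric.ball (0 : Fin m → ℝ) (1 / 10), z ∉ K := by
    by_contra h
    push Not at h
    have h1 : volume (Metric.ball (0 : Fin m → ℝ) (1 / 10)) ≤ volume K := measure_mono h
    rw [hKnull] at h1
    exact absurd h1 (not_le.2 (Metric.measure_ball_pos _ _ (by norm_num)))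
  obtain ⟨δ, hδ, hball⟩ := Metric.isOpen_iff.1 hKc.isOpen_compl z hzK
  let T : (Fin m → ℝ) → (Fin m → ℝ) := fun u i => u i - max (-(1 / 2)) (min (1 / 2) (u i))
  have hT : Continuous T := by fun_prop
  let F : (Fin m → ℝ) → (Fin m → ℝ) := fun x => S x + T (x - S x)
  have hF : Continuous F := hS.add (hT.comp (continuous_id.sub hS))
  have hFd : ∀ x, ‖F x - x‖ ≤ 1 / 2 := by
    intro x
    refine (pi_norm_le_iff_of_nonneg (by norm_num)).2 fun i => ?_
    have : (F x - x) i = - max (-(1 / 2)) (min (1 / 2) ((x - S x) i)) := by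
      simp only [F, T, Pi.sub_apply, Pi.add_apply]; ring
    rw [this, norm_neg, Real.norm_eq_abs, abs_le]
    exact ⟨le_max_left _ _, max_le (by norm_num) (min_le_left _ _)⟩
  have hFK : ∀ x, ‖x‖ ≤ 1 → F x ∈ K := by
    intro x hx
    have hx1 : ∀ i, |x i| ≤ 1 := fun i => (norm_le_pi_norm x i).trans hx
    have hc := count_large q hq k (x - S x) e hlt (herr x hx1)
    obtain ⟨c, φ, hφ, hSx⟩ := hSr ⟨x, rfl⟩
    refine Set.mem_biUnion (x := (⟨fun j => ⟨φ j, hφ j⟩,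
      Finset.univ.filter (fun i => 1 / 2 < |(x - S x) i|)⟩ : (Fin n → Φ) × Finset (Fin m))) hc ?_
    refine Submodule.add_mem_sup ?_ ?_
    · rw [hSx]
      exact Submodule.sum_mem _ fun j _ => Submodule.smul_mem _ _
        (Submodule.subset_span ⟨j, rfl⟩)
    · rw [pi_eq_sum_univ' (T (x - S x))]
      refine Submodule.sum_mem _ fun i _ => ?_
      by_cases hi : 1 / 2 < |(x - S x) i|
      · refine Submodule.smul_mem _ _ (Submodule.subset_span ?_)
        simp only [Finset.coe_image, Set.mem_image, Finset.mem_coe, Finset.mem_filter,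
          Finset.mem_univ, true_and]
        refine ⟨i, hi, ?_⟩
        ext j
        simp [Pi.single_apply, eq_comm]
      · have : T (x - S x) i = 0 := by
          push Not at hi
          rw [abs_le] at hi
          simp only [T]
          rw [min_eq_right hi.2, max_eq_right hi.1, sub_self]
        rw [this, zero_smul]
        exact Submodule.zero_mem _
  refine no_avoid (m := m) (by omega) (fun x => F x - z) (hF.sub continuous_const) ?_ δ hδ ?_
  · intro x _
    have h1 : F x - z - x = (F x - x) - z := by abel
    rw [h1]
    have h2 := norm_sub_le (F x - x) z
    have h3 : ‖z‖ < 1 / 10 := by simpa using hz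
    linarith [hFd x]
  · intro x hx
    by_contra h
    push Not at h
    exact hball (by simpa [dist_eq_norm] using h) (hFK x hx)
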